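/- Assume Dynamics Smoothness holds and that the submatrix Φ_{EJ}(T) of the fundamental matrix at the terminal time is invertible. Then there exist η > 0 and a constant c, independent of Δs, such that for all Δs with |Δs| ≤ η, the boundary-value problem with perturbed switch point, ẋ(t) = F⁺(x(t),t), x_I(0) = b_I, x_E(T) = b_E — where F⁺(χ,t) = F₀(χ,t) for t ∈ [0, s+Δs) and F⁺(χ,t) = F₁(χ,t) for t ∈ (s+Δs, T] — has a solution x⁺ satisfying ‖x⁺_J(0) − x_J(0)‖ ≤ c|Δs|. -/

import Mathlib

open Set Metric

/-- **Dynamics Smoothness** for a dynamics `Fd` with spatial Jacobian `DFd`, on the tube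
`{(χ,t) : t ∈ [a,b], ‖χ - x t‖ ≤ ρ}` around the trajectory `x` :
`Fd` is continuously differentiable on the tube, and `χ ↦ DFd χ t` is Lipschitz
with constant `L`, uniformly in `t`. -/
structure DynSmooth (n : ℕ) (Fd : (Fin n → ℝ) → ℝ → Fin n → ℝ)
    (DFd : (Fin n → ℝ) → ℝ → (Fin n → ℝ) →L[ℝ] (Fin n → ℝ))
    (x : ℝ → Fin n → ℝ) (a b ρ L : ℝ) : Prop where
  contDiffOn : ContDiffOn ℝ 1 (fun p : (Fin n → ℝ) × ℝ => Fd p.1 p.2)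
    {p : (Fin n → ℝ) × ℝ | p.2 ∈ Icc a b ∧ ‖p.1 - x p.2‖ ≤ ρ}
  hasFDeriv : ∀ χ t, t ∈ Icc a b → ‖χ - x t‖ ≤ ρ →
    HasFDerivAt (fun y => Fd y t) (DFd χ t) χ
  contDeriv : ContinuousOn (fun p : (Fin n → ℝ) × ℝ => DFd p.1 p.2)
    {p : (Fin n → ℝ) × ℝ | p.2 ∈ Icc a b ∧ ‖p.1 - x p.2‖ ≤ ρ}
  lip : ∀ t χ₁ χ₂, t ∈ Icc a b → ‖χ₁ - x t‖ ≤ ρ → ‖χ₂ - x t‖ ≤ ρ →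
    ‖DFd χ₁ t - DFd χ₂ t‖ ≤ L * ‖χ₁ - χ₂‖

/-- `y` is a solution of the boundary-value problem with switched dynamics, where the
switch from `F₀` to `F₁` occurs at time `σ`: `ẏ = F₀(y,t)` on `[0,σ)`, `ẏ = F₁(y,t)` on
`(σ,T]`, with boundary conditions `y_I(0) = b_I` and `y_E(T) = b_E`. -/
def IsSwitchSol {n : ℕ} (T σ : ℝ) (I E : Finset (Fin n)) (bI bE : Fin n → ℝ)
    (F₀ F₁ : (Fin n → ℝ) → ℝ → Fin n → ℝ) (y : ℝ → Fin n → ℝ) : Prop :=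
  ContinuousOn y (Icc 0 T) ∧
  (∀ t ∈ Ico 0 σ, HasDerivWithinAt y (F₀ (y t) t) (Icc 0 T) t) ∧
  (∀ t ∈ Ioc σ T, HasDerivWithinAt y (F₁ (y t) t) (Icc 0 T) t) ∧
  (∀ i ∈ I, y 0 i = bI i) ∧
  (∀ i ∈ E, y T i = bE i)

open MeasureTheory

lemma DynSmooth.mono' {n : ℕ} {F : (Fin n → ℝ) → ℝ → Fin n → ℝ}
    {D : (Fin n → ℝ) → ℝ → (Fin n → ℝ) →L[ℝ] (Fin n → ℝ)} {x : ℝ → Fin n → ℝ}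
    {a b ρ L a' b' ρ' L' : ℝ} (h : DynSmooth n F D x a b ρ L) (ha : a ≤ a') (hb : b' ≤ b)
    (hρ : ρ' ≤ ρ) (hL : L ≤ L') : DynSmooth n F D x a' b' ρ' L' := by
  have hsub : {p : (Fin n → ℝ) × ℝ | p.2 ∈ Icc a' b' ∧ ‖p.1 - x p.2‖ ≤ ρ'} ⊆
      {p : (Fin n → ℝ) × ℝ | p.2 ∈ Icc a b ∧ ‖p.1 - x p.2‖ ≤ ρ} :=
    fun p hp => ⟨⟨ha.trans hp.1.1, hp.1.2.trans hb⟩, hp.2.trans hρ⟩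
  refine ⟨h.contDiffOn.mono hsub, ?_, h.contDeriv.mono hsub, ?_⟩
  · intro χ t ht hχ
    exact h.hasFDeriv χ t ⟨ha.trans ht.1, ht.2.trans hb⟩ (hχ.trans hρ)
  · intro t χ₁ χ₂ ht h1 h2
    refine (h.lip t χ₁ χ₂ ⟨ha.trans ht.1, ht.2.trans hb⟩ (h1.trans hρ) (h2.trans hρ)).trans ?_
    gcongr

lemma DynSmooth.cont_comp {n : ℕ} {F : (Fin n → ℝ) → ℝ → Fin n → ℝ}
    {D : (Fin n → ℝ) → ℝ → (Fin n → ℝ) →L[ℝ] (Fin n → ℝ)} {x : ℝ → Fin n → ℝ}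
    {a b ρ L : ℝ} (h : DynSmooth n F D x a b ρ L) {y : ℝ → Fin n → ℝ} {S : Set ℝ}
    (hS : S ⊆ Icc a b)
    (hy : ContinuousOn y S) (hyx : ∀ t ∈ S, ‖y t - x t‖ ≤ ρ) :
    ContinuousOn (fun t => F (y t) t) S := by
  have := h.contDiffOn.continuousOn
  exact this.comp (f := fun t => (y t, t)) (hy.prodMk continuousOn_id)
    (fun t ht => ⟨hS ht, hyx t ht⟩)

lemma DynSmooth.cont_D {n : ℕ} {F : (Fin n → ℝ) → ℝ → Fin n → ℝ}
    {D : (Fin n → ℝ) → ℝ → (Fin n → ℝ) →L[ℝ] (Fin n → ℝ)} {x : ℝ → Fin n → ℝ}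
    {a b ρ L : ℝ} (h : DynSmooth n F D x a b ρ L) (hρ : 0 ≤ ρ) {S : Set ℝ}
    (hS : S ⊆ Icc a b)
    (hx : ContinuousOn x S) :
    ContinuousOn (fun t => D (x t) t) S :=
  h.contDeriv.comp (f := fun t => (x t, t)) (hx.prodMk continuousOn_id)
    (fun t ht => ⟨hS ht, by simpa using hρ⟩)

lemma DynSmooth.est {n : ℕ} {F : (Fin n → ℝ) → ℝ → Fin n → ℝ}
    {D : (Fin n → ℝ) → ℝ → (Fin n → ℝ) →L[ℝ] (Fin n → ℝ)} {x : ℝ → Fin n → ℝ}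
    {a b ρ L : ℝ} (h : DynSmooth n F D x a b ρ L) (hL : 0 ≤ L) {r t : ℝ} (hr : r ≤ ρ)
    (ht : t ∈ Icc a b) {z w : Fin n → ℝ} (hz : ‖z‖ ≤ r) (hw : ‖w‖ ≤ r) :
    ‖(F (x t + z) t - D (x t) t z) - (F (x t + w) t - D (x t) t w)‖ ≤ L * r * ‖z - w‖ := by
  have hr0 : 0 ≤ r := (norm_nonneg z).trans hz
  have key := Convex.norm_image_sub_le_of_norm_hasFDerivWithin_le (𝕜 := ℝ)
    (f := fun u => F (x t + u) t - D (x t) t u) (C := L * r) (s := closedBall 0 r)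
    (x := w) (y := z) (f' := fun u => D (x t + u) t - D (x t) t) ?_ ?_ (convex_closedBall _ _)
    (by simpa using hw) (by simpa using hz)
  · exact key
  · intro u hu
    have hu' : ‖u‖ ≤ r := by simpa using hu
    have h1 := h.hasFDeriv (x t + u) t ht (by simpa using hu'.trans hr)
    have h2 : HasFDerivAt (fun u => F (x t + u) t) (D (x t + u) t) u := by
      have := h1.comp u ((hasFDerivAt_id u).const_add (x t))
      simpa [Function.comp_def] using this
    exact (h2.sub (D (x t) t).hasFDerivAt).hasFDerivWithinAt
  · intro u hu
    have hu' : ‖u‖ ≤ r := by simpa using hu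
    have := h.lip t (x t + u) (x t) ht (by simpa using hu'.trans hr)
      (by simpa using hr0.trans hr)
    refine this.trans ?_
    have : x t + u - x t = u := by abel
    rw [this]
    gcongr

lemma DynSmooth.est2 {n : ℕ} {F : (Fin n → ℝ) → ℝ → Fin n → ℝ}
    {D : (Fin n → ℝ) → ℝ → (Fin n → ℝ) →L[ℝ] (Fin n → ℝ)} {x : ℝ → Fin n → ℝ}
    {a b ρ L : ℝ} (h : DynSmooth n F D x a b ρ L) (hL : 0 ≤ L) {t M : ℝ}
    (ht : t ∈ Icc a b) {z w : Fin n → ℝ} (hz : ‖z‖ ≤ ρ) (hw : ‖w‖ ≤ ρ)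
    (hM : ‖D (x t) t‖ ≤ M) :
    ‖F (x t + z) t - F (x t + w) t‖ ≤ (L * ρ + M) * ‖z - w‖ := by
  have h1 := h.est hL le_rfl ht hz hw
  have h2 : ‖D (x t) t (z - w)‖ ≤ M * ‖z - w‖ := (D (x t) t).le_of_opNorm_le hM _
  have h3 : F (x t + z) t - F (x t + w) t =
    ((F (x t + z) t - D (x t) t z) - (F (x t + w) t - D (x t) t w)) + D (x t) t (z - w) := by
    rw [map_sub]; abel
  rw [h3]
  refine (norm_add_le _ _).trans ?_
  linarith

/-- A continuous function whose derivative off a countable set is continuous is `C¹`. -/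
lemma hasDeriv_of_off_countable {E : Type*} [NormedAddCommGroup E] [NormedSpace ℝ E]
    [CompleteSpace E] {y f : ℝ → E} {a b : ℝ} {S : Set ℝ} (hS : S.Countable)
    (hy : ContinuousOn y (Icc a b)) (hd : ∀ t ∈ Ioo a b \ S, HasDerivAt y (f t) t)
    (hf : ContinuousOn f (Icc a b)) :
    ∀ t ∈ Icc a b, HasDerivWithinAt y (f t) (Icc a b) t := by
  intro t ht
  have hab : a ≤ b := ht.1.trans ht.2
  have hint : ∀ u ∈ Icc a b, y u = y a + ∫ v in a..u, f v := by
    intro u hu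
    have hsub : Icc a u ⊆ Icc a b := Icc_subset_Icc le_rfl hu.2
    rw [integral_eq_of_hasDerivAt_off_countable_of_le y f hu.1 hS (hy.mono hsub)
      (fun v hv => hd v ⟨⟨hv.1.1, hv.1.2.trans_le hu.2⟩, hv.2⟩)
      ((hf.mono hsub).intervalIntegrable_of_Icc hu.1)]
    abel
  have : Fact (t ∈ Icc a b) := ⟨ht⟩
  have h1 : HasDerivWithinAt (fun u => ∫ v in a..u, f v) (f t) (Icc a b) t := by
    refine intervalIntegral.integral_hasDerivWithinAt_right
      ((hf.mono (Icc_subset_Icc le_rfl ht.2)).intervalIntegrable_of_Icc ht.1) ?_ (hf t ht)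
    exact hf.stronglyMeasurableAtFilter_nhdsWithin measurableSet_Icc t
  exact (h1.const_add (y a)).congr hint (hint t ht)

lemma fixed_pt {X : Type*} [NormedAddCommGroup X] [CompleteSpace X] {r : ℝ} (hr : 0 ≤ r)
    (P : X → X) (hP : ∀ z w, ‖z‖ ≤ r → ‖w‖ ≤ r → ‖P z - P w‖ ≤ (1/2) * ‖z - w‖)
    (h0 : ‖P 0‖ ≤ r / 2) : ∃ z, ‖z‖ ≤ r ∧ P z = z ∧ ‖z‖ ≤ 2 * ‖P 0‖ := by
  have hmaps : MapsTo P (closedBall 0 r) (closedBall 0 r) := by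
    intro z hz
    have hz' : ‖z‖ ≤ r := by simpa using hz
    have h1 := hP z 0 hz' (by simpa using hr)
    have h2 : ‖P z‖ ≤ ‖P z - P 0‖ + ‖P 0‖ := by
      simpa using norm_add_le (P z - P 0) (P 0)
    rw [sub_zero] at h1
    simp only [mem_closedBall, dist_zero_right]
    linarith
  have hc : ContractingWith (1/2) (hmaps.restrict P _ _) := by
    refine ⟨by rw [← NNReal.coe_lt_coe]; norm_num, ?_⟩
    refine LipschitzWith.of_dist_le_mul ?_
    rintro ⟨z, hz⟩ ⟨w, hw⟩
    have := hP z w (by simpa using hz) (by simpa using hw)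
    simpa [Subtype.dist_eq, dist_eq_norm] using this
  obtain ⟨z, hz, hfix, -⟩ := ContractingWith.exists_fixedPoint' (isClosed_closedBall.isComplete)
    hmaps hc (x := 0) (by simpa using hr) (edist_ne_top _ _)
  have hz' : ‖z‖ ≤ r := by simpa using hz
  have hfix' : P z = z := hfix
  refine ⟨z, hz', hfix', ?_⟩
  have h1 := hP z 0 hz' (by simpa using hr)
  have h2 : ‖P z‖ ≤ ‖P z - P 0‖ + ‖P 0‖ := by
    simpa using norm_add_le (P z - P 0) (P 0)
  rw [sub_zero] at h1
  rw [hfix'] at h1 h2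
  linarith

lemma exists_B {n : ℕ} (I E : Finset (Fin n)) (A : (Fin n → ℝ) →L[ℝ] (Fin n → ℝ))
    (N : Matrix {j // j ∈ Iᶜ} {e // e ∈ E} ℝ)
    (hN₁ : (LinearMap.toMatrix' (A : (Fin n → ℝ) →ₗ[ℝ] Fin n → ℝ)).submatrix
        (Subtype.val : {e // e ∈ E} → Fin n) (Subtype.val : {j // j ∈ Iᶜ} → Fin n) * N = 1) :
    ∃ B : (Fin n → ℝ) →L[ℝ] (Fin n → ℝ), (∀ v, ∀ i ∈ I, B v i = 0) ∧
      ∀ v, ∀ e ∈ E, A (B v + v) e = 0 := by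
  classical
  let B0 : (Fin n → ℝ) →ₗ[ℝ] (Fin n → ℝ) :=
    { toFun := fun v i => if h : i ∈ Iᶜ then -(N.mulVec (fun e => A v e.1)) ⟨i, h⟩ else 0
      map_add' := by
        intro u v
        ext i
        by_cases h : i ∈ Iᶜ
        · have : (fun e : {e // e ∈ E} => A (u + v) e.1) =
            (fun e : {e // e ∈ E} => A u e.1) + (fun e : {e // e ∈ E} => A v e.1) := by
            ext e; simp
          simp only [dif_pos h, Pi.add_apply, this, Matrix.mulVec_add]
          ring
        · simp only [dif_neg h, Pi.add_apply, add_zero]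
      map_smul' := by
        intro c v
        ext i
        by_cases h : i ∈ Iᶜ
        · have : (fun e : {e // e ∈ E} => A (c • v) e.1) =
            c • (fun e : {e // e ∈ E} => A v e.1) := by
            ext e; simp
          simp only [dif_pos h, Pi.smul_apply, this, Matrix.mulVec_smul, RingHom.id_apply,
            smul_eq_mul]
          ring
        · simp only [dif_neg h, Pi.smul_apply, RingHom.id_apply, smul_zero] }
  have hB0 : ∀ v i, B0 v i =
      if h : i ∈ Iᶜ then -(N.mulVec (fun e => A v e.1)) ⟨i, h⟩ else 0 := fun v i => rfl
  refine ⟨LinearMap.toContinuousLinearMap B0, ?_, ?_⟩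
  · intro v i hi
    simp only [LinearMap.coe_toContinuousLinearMap', hB0]
    rw [dif_neg (by simpa using hi)]
  · intro v e he
    simp only [LinearMap.coe_toContinuousLinearMap', map_add, Pi.add_apply]
    set M := LinearMap.toMatrix' (A : (Fin n → ℝ) →ₗ[ℝ] Fin n → ℝ) with hM
    set u : {e // e ∈ E} → ℝ := fun e => A v e.1 with hu
    have h1 : A (B0 v) e = ∑ i, M e i * B0 v i := by
      have := LinearMap.toMatrix'_mulVec (A : (Fin n → ℝ) →ₗ[ℝ] Fin n → ℝ) (B0 v)
      have := congrFun this e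
      exact this.symm
    have h2 : ∑ i, M e i * B0 v i = ∑ i ∈ Iᶜ, M e i * B0 v i := by
      symm
      apply Finset.sum_subset (Finset.subset_univ _)
      intro i _ hi
      rw [hB0, dif_neg hi, mul_zero]
    have h3 : ∑ i ∈ Iᶜ, M e i * B0 v i = ∑ j : {j // j ∈ Iᶜ}, M e j * -(N.mulVec u) j := by
      rw [← Finset.sum_coe_sort]
      refine Finset.sum_congr rfl ?_
      intro j _
      rw [hB0, dif_pos j.2]
    have h4 := congrFun (congrArg (fun X => Matrix.mulVec X u) hN₁) ⟨e, he⟩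
    simp only [← Matrix.mulVec_mulVec, Matrix.one_mulVec] at h4
    rw [h1, h2, h3]
    have h5 : ∑ j : {j // j ∈ Iᶜ}, M e j * (N.mulVec u) j = u ⟨e, he⟩ := h4
    simp only [mul_neg, Finset.sum_neg_distrib]
    rw [h5]
    simp [hu]

lemma zero_back {n : ℕ} {A : ℝ → (Fin n → ℝ) →L[ℝ] (Fin n → ℝ)} {f : ℝ → Fin n → ℝ} {a b : ℝ}
    (hab : a ≤ b) (hA : ContinuousOn A (Icc a b))
    (hf : ∀ t ∈ Icc a b, HasDerivWithinAt f (A t (f t)) (Icc a b) t) (hb : f b = 0) :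
    f a = 0 := by
  obtain ⟨K, hK⟩ := isCompact_Icc.exists_bound_of_continuousOn hA
  have hfc : ContinuousOn f (Icc a b) := fun t ht => (hf t ht).continuousWithinAt
  have := ODE_solution_unique_of_mem_Icc_left (v := fun t y => A t y) (s := fun _ => univ)
    (K := K.toNNReal) (f := f) (g := fun _ => 0) (a := a) (b := b) ?_ hfc ?_
    (fun _ _ => mem_univ _) continuousOn_const ?_ (fun _ _ => mem_univ _) hb
  · exact this ⟨le_rfl, hab⟩
  · intro t ht
    have h1 : ‖A t‖₊ ≤ K.toNNReal := by
      rw [← NNReal.coe_le_coe]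
      exact (hK t ⟨ht.1.le, ht.2⟩).trans (Real.le_coe_toNNReal K)
    exact ((A t).lipschitz.weaken h1).lipschitzOnWith
  · intro t ht
    refine (hf t ⟨ht.1.le, ht.2⟩).mono_of_mem_nhdsWithin ?_
    have : Ioc a t ∈ nhdsWithin t (Iic t) := Ioc_mem_nhdsLE ht.1
    exact Filter.mem_of_superset this (fun u hu => ⟨hu.1.le, hu.2.trans ht.2⟩)
  · intro t ht
    simpa using hasDerivWithinAt_const t (Iic t) (0 : Fin n → ℝ)

lemma exists_Psi {n : ℕ} {T s : ℝ} (hs : s ∈ Ioo 0 T)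
    {A₀ A₁ Φ : ℝ → (Fin n → ℝ) →L[ℝ] (Fin n → ℝ)}
    (hA₀ : ContinuousOn A₀ (Icc 0 s)) (hA₁ : ContinuousOn A₁ (Icc s T))
    (hΦc : ContinuousOn Φ (Icc 0 T))
    (hΦ0 : Φ 0 = ContinuousLinearMap.id ℝ (Fin n → ℝ))
    (hΦode : ∀ t ∈ Icc 0 T, t ≠ s → HasDerivWithinAt Φ
      ((if t < s then A₀ t else A₁ t).comp (Φ t)) (Icc 0 T) t) :
    ∃ Ψ : ℝ → (Fin n → ℝ) →L[ℝ] (Fin n → ℝ), ContinuousOn Ψ (Icc 0 T) ∧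
      ∀ t ∈ Icc 0 T, ∀ v, Φ t (Ψ t v) = v := by
  have hsub0 : Icc 0 s ⊆ Icc 0 T := Icc_subset_Icc le_rfl hs.2.le
  have hsub1 : Icc s T ⊆ Icc 0 T := Icc_subset_Icc hs.1.le le_rfl
  have hat : ∀ t ∈ Ioo 0 T, t ≠ s → HasDerivAt Φ
      ((if t < s then A₀ t else A₁ t).comp (Φ t)) t := fun t ht hne =>
    (hΦode t (Ioo_subset_Icc_self ht) hne).hasDerivAt (Icc_mem_nhds ht.1 ht.2)
  have hd0 : ∀ t ∈ Icc 0 s, HasDerivWithinAt Φ ((A₀ t).comp (Φ t)) (Icc 0 s) t := by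
    refine hasDeriv_of_off_countable countable_empty (hΦc.mono hsub0) ?_
      (hA₀.clm_comp (hΦc.mono hsub0))
    intro t ht
    have := hat t ⟨ht.1.1, ht.1.2.trans hs.2⟩ ht.1.2.ne
    rwa [if_pos ht.1.2] at this
  have hd1 : ∀ t ∈ Icc s T, HasDerivWithinAt Φ ((A₁ t).comp (Φ t)) (Icc s T) t := by
    refine hasDeriv_of_off_countable countable_empty (hΦc.mono hsub1) ?_
      (hA₁.clm_comp (hΦc.mono hsub1))
    intro t ht
    have := hat t ⟨hs.1.trans ht.1.1, ht.1.2⟩ ht.1.1.ne'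
    rwa [if_neg ht.1.1.not_gt] at this
  have step0 : ∀ t ∈ Icc 0 s, ∀ v, Φ t v = 0 → v = 0 := by
    intro t ht v hv
    have := zero_back (A := A₀) (f := fun u => Φ u v) ht.1
      (hA₀.mono (Icc_subset_Icc le_rfl ht.2)) ?_ hv
    · simpa [hΦ0] using this
    · intro u hu
      have h1 := (hd0 u ⟨hu.1, hu.2.trans ht.2⟩).mono
        (Icc_subset_Icc le_rfl ht.2 : Icc 0 t ⊆ Icc 0 s)
      simpa using h1.clm_apply (hasDerivWithinAt_const u _ v)
  have step1 : ∀ t ∈ Icc s T, ∀ v, Φ t v = 0 → Φ s v = 0 := by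
    intro t ht v hv
    refine zero_back (A := A₁) (f := fun u => Φ u v) ht.1
      (hA₁.mono (Icc_subset_Icc le_rfl ht.2)) ?_ hv
    intro u hu
    have h1 := (hd1 u ⟨hu.1, hu.2.trans ht.2⟩).mono
      (Icc_subset_Icc le_rfl ht.2 : Icc s t ⊆ Icc s T)
    simpa using h1.clm_apply (hasDerivWithinAt_const u _ v)
  have inj : ∀ t ∈ Icc 0 T, ∀ v, Φ t v = 0 → v = 0 := by
    intro t ht v hv
    rcases le_total t s with h | h
    · exact step0 t ⟨ht.1, h⟩ v hv
    · exact step0 s ⟨hs.1.le, le_rfl⟩ v (step1 t ⟨h, ht.2⟩ v hv)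
  have unit : ∀ t ∈ Icc 0 T, IsUnit (Φ t) := by
    intro t ht
    rw [ContinuousLinearMap.isUnit_iff_bijective]
    have hi : Function.Injective (Φ t : (Fin n → ℝ) →ₗ[ℝ] (Fin n → ℝ)) :=
      (injective_iff_map_eq_zero _).2 (inj t ht)
    exact ⟨hi, LinearMap.injective_iff_surjective.1 hi⟩
  refine ⟨fun t => Ring.inverse (Φ t), ?_, ?_⟩
  · intro t ht
    obtain ⟨u, hu⟩ := unit t ht
    have h1 := NormedRing.inverse_continuousAt u
    rw [hu] at h1
    exact h1.comp_continuousWithinAt (hΦc t ht)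
  · intro t ht v
    have := Ring.mul_inverse_cancel _ (unit t ht)
    exact congrArg (fun X : (Fin n → ℝ) →L[ℝ] (Fin n → ℝ) => X v) this

lemma sw_integrable {E : Type*} [NormedAddCommGroup E] {f g : ℝ → E} {a b c : ℝ}
    (hc : c ∈ Icc a b) (hf : ContinuousOn f (Icc a c)) (hg : ContinuousOn g (Icc c b)) :
    IntegrableOn (fun t => if t < c then f t else g t) (Icc a b) := by
  have h1 : IntegrableOn (fun t => if t < c then f t else g t) (Ico a c) := by
    refine ((hf.integrableOn_Icc (μ := volume)).mono_set Ico_subset_Icc_self).congr_fun ?_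
      measurableSet_Ico
    intro t ht
    simp only [if_pos ht.2]
  have h2 : IntegrableOn (fun t => if t < c then f t else g t) (Icc c b) := by
    refine (hg.integrableOn_Icc (μ := volume)).congr_fun ?_ measurableSet_Icc
    intro t ht
    simp only [if_neg ht.1.not_gt]
  have := h1.union h2
  rwa [Ico_union_Icc_eq_Icc hc.1 hc.2] at this

lemma sw_contAt {E : Type*} [TopologicalSpace E] {f g : ℝ → E} {a b c t : ℝ}
    (hf : ContinuousOn f (Icc a c)) (hg : ContinuousOn g (Icc c b))
    (ht : t ∈ Ioo a b) (hne : t ≠ c) :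
    ContinuousAt (fun t => if t < c then f t else g t) t := by
  rcases lt_or_gt_of_ne hne with h | h
  · refine (hf.continuousAt (Icc_mem_nhds ht.1 h)).congr ?_
    filter_upwards [Iio_mem_nhds h] with u hu
    simp only [if_pos (mem_Iio.1 hu)]
  · refine (hg.continuousAt (Icc_mem_nhds h ht.2)).congr ?_
    filter_upwards [Ioi_mem_nhds h] with u hu
    simp only [if_neg (mem_Ioi.1 hu).not_gt]

lemma int_bound {E : Type*} [NormedAddCommGroup E] [NormedSpace ℝ E] {q : ℝ → E}
    {T s σ a b : ℝ} (ha : 0 ≤ a) (hb : 0 ≤ b)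
    (hq : ∀ t ∈ Icc 0 T, ‖q t‖ ≤ a + (uIcc s σ).indicator (fun _ => b) t) :
    ∀ t ∈ Icc 0 T, ‖∫ u in (0:ℝ)..t, q u‖ ≤ a * T + b * |σ - s| := by
  intro t ht
  have hi : Integrable ((uIcc s σ).indicator (fun _ => b)) volume := by
    rw [integrable_indicator_iff measurableSet_uIcc]
    exact integrableOn_const (by rw [Real.volume_interval]; exact ENNReal.ofReal_ne_top)
  have hc : IntervalIntegrable (fun _ : ℝ => a) volume 0 t := intervalIntegrable_const
  have h1 := intervalIntegral.norm_integral_le_of_norm_le (f := q) (μ := volume)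
    (g := fun u => a + (uIcc s σ).indicator (fun _ => b) u) ht.1
    (Filter.Eventually.of_forall fun u hu => hq u ⟨hu.1.le, hu.2.trans ht.2⟩)
    (hc.add hi.intervalIntegrable)
  refine h1.trans ?_
  rw [intervalIntegral.integral_add hc hi.intervalIntegrable, intervalIntegral.integral_const]
  have h2 : ∫ u in (0:ℝ)..t, (uIcc s σ).indicator (fun _ => b) u ≤ b * |σ - s| := by
    rw [intervalIntegral.integral_of_le ht.1]
    refine (setIntegral_le_integral hi (Filter.Eventually.of_forall
      fun u => indicator_nonneg (fun _ _ => hb) u)).trans ?_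
    rw [integral_indicator measurableSet_uIcc, setIntegral_const]
    simp [Measure.real, Real.volume_interval, mul_comm]
  have h3 : (t - 0) • a ≤ a * T := by
    rw [sub_zero, smul_eq_mul, mul_comm]
    exact mul_le_mul_of_nonneg_left ht.2 ha
  linarith

/-- Standing assumptions after shrinking the tube radius. -/
structure Setup (n : ℕ) (T s ρ L M C : ℝ) (F₀ F₁ : (Fin n → ℝ) → ℝ → Fin n → ℝ)
    (D₀ D₁ : (Fin n → ℝ) → ℝ → (Fin n → ℝ) →L[ℝ] (Fin n → ℝ)) (x : ℝ → Fin n → ℝ) : Prop where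
  hρ : 0 < ρ
  h1 : 0 < s - ρ
  h2 : s + ρ < T
  hL : 0 ≤ L
  d0 : DynSmooth n F₀ D₀ x 0 (s + ρ) ρ L
  d1 : DynSmooth n F₁ D₁ x (s - ρ) T ρ L
  xc : ContinuousOn x (Icc 0 T)
  xd0 : ∀ t ∈ Ico 0 s, HasDerivWithinAt x (F₀ (x t) t) (Icc 0 T) t
  xd1 : ∀ t ∈ Ioc s T, HasDerivWithinAt x (F₁ (x t) t) (Icc 0 T) t
  m0 : ∀ t ∈ Icc 0 (s + ρ), ‖D₀ (x t) t‖ ≤ M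
  m1 : ∀ t ∈ Icc (s - ρ) T, ‖D₁ (x t) t‖ ≤ M
  c0 : ∀ t ∈ Icc 0 (s + ρ), ‖F₀ (x t) t‖ ≤ C
  c1 : ∀ t ∈ Icc (s - ρ) T, ‖F₁ (x t) t‖ ≤ C

noncomputable def swG {n : ℕ} (s σ : ℝ) (F₀ F₁ : (Fin n → ℝ) → ℝ → Fin n → ℝ)
    (D₀ D₁ : (Fin n → ℝ) → ℝ → (Fin n → ℝ) →L[ℝ] (Fin n → ℝ)) (x z : ℝ → Fin n → ℝ)
    (t : ℝ) : Fin n → ℝ :=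
  (if t < σ then F₀ (x t + z t) t else F₁ (x t + z t) t)
    - (if t < s then F₀ (x t) t else F₁ (x t) t)
    - (if t < s then D₀ (x t) t (z t) else D₁ (x t) t (z t))

section
variable {n : ℕ} {T s ρ L M C : ℝ} {F₀ F₁ : (Fin n → ℝ) → ℝ → Fin n → ℝ}
    {D₀ D₁ : (Fin n → ℝ) → ℝ → (Fin n → ℝ) →L[ℝ] (Fin n → ℝ)} {x : ℝ → Fin n → ℝ}

lemma Setup.sub0 (S : Setup n T s ρ L M C F₀ F₁ D₀ D₁ x) {σ : ℝ} (hσ : |σ - s| ≤ ρ) :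
    Icc 0 σ ⊆ Icc 0 (s + ρ) ∧ Icc 0 σ ⊆ Icc 0 T ∧ Icc σ T ⊆ Icc (s - ρ) T ∧ Icc σ T ⊆ Icc 0 T
    ∧ σ ∈ Ioo 0 T := by
  have := abs_le.1 hσ
  have h1 := S.h1
  have h2 := S.h2
  refine ⟨Icc_subset_Icc le_rfl (by linarith), Icc_subset_Icc le_rfl (by linarith),
    Icc_subset_Icc (by linarith) le_rfl, Icc_subset_Icc (by linarith) le_rfl,
    ⟨by linarith, by linarith⟩⟩

lemma Setup.contF (S : Setup n T s ρ L M C F₀ F₁ D₀ D₁ x) {σ : ℝ} (hσ : |σ - s| ≤ ρ)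
    {z : ℝ → Fin n → ℝ} (hz : ContinuousOn z (Icc 0 T)) (hzρ : ∀ t ∈ Icc 0 T, ‖z t‖ ≤ ρ) :
    ContinuousOn (fun t => F₀ (x t + z t) t) (Icc 0 σ) ∧
    ContinuousOn (fun t => F₁ (x t + z t) t) (Icc σ T) := by
  obtain ⟨a1, a2, a3, a4, a5⟩ := S.sub0 hσ
  refine ⟨S.d0.cont_comp a1 ((S.xc.add hz).mono a2) ?_,
    S.d1.cont_comp a3 ((S.xc.add hz).mono a4) ?_⟩
  · intro t ht; simpa using hzρ t (a2 ht)
  · intro t ht; simpa using hzρ t (a4 ht)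

lemma Setup.contD (S : Setup n T s ρ L M C F₀ F₁ D₀ D₁ x)
    {z : ℝ → Fin n → ℝ} (hz : ContinuousOn z (Icc 0 T)) :
    ContinuousOn (fun t => D₀ (x t) t (z t)) (Icc 0 s) ∧
    ContinuousOn (fun t => D₁ (x t) t (z t)) (Icc s T) := by
  obtain ⟨a1, a2, a3, a4, a5⟩ := S.sub0 (σ := s) (by simpa using S.hρ.le)
  exact ⟨(S.d0.cont_D S.hρ.le a1 (S.xc.mono a2)).clm_apply (hz.mono a2),
    (S.d1.cont_D S.hρ.le a3 (S.xc.mono a4)).clm_apply (hz.mono a4)⟩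

lemma Setup.contF' (S : Setup n T s ρ L M C F₀ F₁ D₀ D₁ x) :
    ContinuousOn (fun t => F₀ (x t) t) (Icc 0 s) ∧
    ContinuousOn (fun t => F₁ (x t) t) (Icc s T) := by
  have := S.contF (σ := s) (by simpa using S.hρ.le) (z := fun _ => 0) continuousOn_const
    (by simpa using fun _ _ _ => S.hρ.le)
  simpa using this

lemma Setup.integrable (S : Setup n T s ρ L M C F₀ F₁ D₀ D₁ x) {σ : ℝ} (hσ : |σ - s| ≤ ρ)
    {z : ℝ → Fin n → ℝ} (hz : ContinuousOn z (Icc 0 T)) (hzρ : ∀ t ∈ Icc 0 T, ‖z t‖ ≤ ρ) :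
    IntegrableOn (swG s σ F₀ F₁ D₀ D₁ x z) (Icc 0 T) := by
  obtain ⟨a1, a2, a3, a4, a5⟩ := S.sub0 hσ
  obtain ⟨-, -, -, -, b5⟩ := S.sub0 (σ := s) (by simpa using S.hρ.le)
  have i1 := sw_integrable (Ioo_subset_Icc_self a5) (S.contF hσ hz hzρ).1 (S.contF hσ hz hzρ).2
  have i2 := sw_integrable (Ioo_subset_Icc_self b5) S.contF'.1 S.contF'.2
  have i3 := sw_integrable (Ioo_subset_Icc_self b5) (S.contD hz).1 (S.contD hz).2
  exact (Integrable.sub (Integrable.sub i1 i2) i3)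

lemma Setup.contAt (S : Setup n T s ρ L M C F₀ F₁ D₀ D₁ x) {σ : ℝ} (hσ : |σ - s| ≤ ρ)
    {z : ℝ → Fin n → ℝ} (hz : ContinuousOn z (Icc 0 T)) (hzρ : ∀ t ∈ Icc 0 T, ‖z t‖ ≤ ρ)
    {t : ℝ} (ht : t ∈ Ioo 0 T) (h1 : t ≠ s) (h2 : t ≠ σ) :
    ContinuousAt (swG s σ F₀ F₁ D₀ D₁ x z) t := by
  have i1 := sw_contAt (S.contF hσ hz hzρ).1 (S.contF hσ hz hzρ).2 ht h2
  have i2 := sw_contAt S.contF'.1 S.contF'.2 ht h1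
  have i3 := sw_contAt (S.contD hz).1 (S.contD hz).2 ht h1
  exact (i1.sub i2).sub i3

lemma Setup.zero_bd (S : Setup n T s ρ L M C F₀ F₁ D₀ D₁ x) {σ : ℝ} (hσ : |σ - s| ≤ ρ)
    {t : ℝ} (ht : t ∈ Icc 0 T) :
    ‖swG s σ F₀ F₁ D₀ D₁ x (fun _ => 0) t‖ ≤ 0 + (uIcc s σ).indicator (fun _ => 2 * C) t := by
  have hab := abs_le.1 hσ
  have hC : 0 ≤ C := (norm_nonneg _).trans (S.c0 0 ⟨le_rfl, by linarith [S.h1, S.hρ]⟩)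
  have hnn : 0 ≤ (uIcc s σ).indicator (fun _ => 2 * C) t :=
    indicator_nonneg (fun _ _ => by linarith) t
  have hρ := S.hρ
  unfold swG
  simp only [add_zero, map_zero, ite_self, sub_zero, zero_add]
  by_cases h1 : t < σ <;> by_cases h2 : t < s
  · simpa [h1, h2] using hnn
  · rw [if_pos h1, if_neg h2, indicator_of_mem (by rw [mem_uIcc]; left; exact ⟨not_lt.1 h2, h1.le⟩)]
    have e0 := S.c0 t ⟨ht.1, by linarith⟩
    have e1 := S.c1 t ⟨by linarith, ht.2⟩
    exact (norm_sub_le _ _).trans (by linarith)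
  · rw [if_neg h1, if_pos h2, indicator_of_mem (by rw [mem_uIcc]; right; exact ⟨not_lt.1 h1, h2.le⟩)]
    have e0 := S.c0 t ⟨ht.1, by linarith⟩
    have e1 := S.c1 t ⟨by linarith, ht.2⟩
    exact (norm_sub_le _ _).trans (by linarith)
  · simpa [h1, h2] using hnn

lemma Setup.lip_bd (S : Setup n T s ρ L M C F₀ F₁ D₀ D₁ x) {σ : ℝ} (hσ : |σ - s| ≤ ρ)
    {z w : ℝ → Fin n → ℝ} {r d : ℝ} (hr : r ≤ ρ)
    {t : ℝ} (ht : t ∈ Icc 0 T) (hz : ‖z t‖ ≤ r) (hw : ‖w t‖ ≤ r) (hd : ‖z t - w t‖ ≤ d) :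
    ‖swG s σ F₀ F₁ D₀ D₁ x z t - swG s σ F₀ F₁ D₀ D₁ x w t‖ ≤
      L * r * d + (uIcc s σ).indicator (fun _ => (L * ρ + 2 * M) * d) t := by
  have hab := abs_le.1 hσ
  have hρ := S.hρ
  have hL := S.hL
  have hM : 0 ≤ M := (norm_nonneg _).trans (S.m0 0 ⟨le_rfl, by linarith [S.h1, S.hρ]⟩)
  have hd0 : 0 ≤ d := (norm_nonneg _).trans hd
  have hr0 : 0 ≤ r := (norm_nonneg _).trans hz
  have hLr : L * r * ‖z t - w t‖ ≤ L * r * d := by gcongr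
  have hLM : (L * ρ + M) * ‖z t - w t‖ ≤ (L * ρ + M) * d := by gcongr
  have hMd : M * ‖z t - w t‖ ≤ M * d := by gcongr
  have hLrd : 0 ≤ L * r * d := by positivity
  have hnn : 0 ≤ (uIcc s σ).indicator (fun _ => (L * ρ + 2 * M) * d) t :=
    indicator_nonneg (fun _ _ => by positivity) t
  unfold swG
  by_cases h1 : t < σ <;> by_cases h2 : t < s
  · simp only [if_pos h1, if_pos h2]
    have := S.d0.est hL hr (t := t) ⟨ht.1, by linarith⟩ hz hw
    have e : F₀ (x t + z t) t - F₀ (x t) t - D₀ (x t) t (z t)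
      - (F₀ (x t + w t) t - F₀ (x t) t - D₀ (x t) t (w t)) =
      (F₀ (x t + z t) t - D₀ (x t) t (z t)) - (F₀ (x t + w t) t - D₀ (x t) t (w t)) := by abel
    rw [e]
    linarith
  · simp only [if_pos h1, if_neg h2]
    rw [indicator_of_mem (by rw [mem_uIcc]; left; exact ⟨not_lt.1 h2, h1.le⟩)]
    have e0 : t ∈ Icc 0 (s + ρ) := ⟨ht.1, by linarith⟩
    have e1 : t ∈ Icc (s - ρ) T := ⟨by linarith, ht.2⟩
    have k1 := S.d0.est2 hL e0 (hz.trans hr) (hw.trans hr) (S.m0 t e0)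
    have k2 := (D₁ (x t) t).le_of_opNorm_le (S.m1 t e1) (z t - w t)
    have e : F₀ (x t + z t) t - F₁ (x t) t - D₁ (x t) t (z t)
      - (F₀ (x t + w t) t - F₁ (x t) t - D₁ (x t) t (w t)) =
      (F₀ (x t + z t) t - F₀ (x t + w t) t) - D₁ (x t) t (z t - w t) := by rw [map_sub]; abel
    rw [e]
    refine (norm_sub_le _ _).trans ?_
    linarith
  · simp only [if_neg h1, if_pos h2]
    rw [indicator_of_mem (by rw [mem_uIcc]; right; exact ⟨not_lt.1 h1, h2.le⟩)]
    have e0 : t ∈ Icc 0 (s + ρ) := ⟨ht.1, by linarith⟩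
    have e1 : t ∈ Icc (s - ρ) T := ⟨by linarith, ht.2⟩
    have k1 := S.d1.est2 hL e1 (hz.trans hr) (hw.trans hr) (S.m1 t e1)
    have k2 := (D₀ (x t) t).le_of_opNorm_le (S.m0 t e0) (z t - w t)
    have e : F₁ (x t + z t) t - F₀ (x t) t - D₀ (x t) t (z t)
      - (F₁ (x t + w t) t - F₀ (x t) t - D₀ (x t) t (w t)) =
      (F₁ (x t + z t) t - F₁ (x t + w t) t) - D₀ (x t) t (z t - w t) := by rw [map_sub]; abel
    rw [e]
    refine (norm_sub_le _ _).trans ?_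
    linarith
  · simp only [if_neg h1, if_neg h2]
    have := S.d1.est hL hr (t := t) ⟨by linarith, ht.2⟩ hz hw
    have e : F₁ (x t + z t) t - F₁ (x t) t - D₁ (x t) t (z t)
      - (F₁ (x t + w t) t - F₁ (x t) t - D₁ (x t) t (w t)) =
      (F₁ (x t + z t) t - D₁ (x t) t (z t)) - (F₁ (x t + w t) t - D₁ (x t) t (w t)) := by abel
    rw [e]
    linarith

end

lemma aux_small_prod {k e y : ℝ} (hk : 0 ≤ k) (he : 0 ≤ e) (hy : y ≤ e / (k + 1)) : k * y ≤ e := by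
  have h1 : k * y ≤ k * (e / (k + 1)) := mul_le_mul_of_nonneg_left hy hk
  have h2 : k * (e / (k + 1)) = e * (k / (k + 1)) := by ring
  have h3 : k / (k + 1) ≤ 1 := (div_le_one (by linarith)).2 (by linarith)
  nlinarith

section
variable {n : ℕ} {T s ρ L M C : ℝ} {F₀ F₁ : (Fin n → ℝ) → ℝ → Fin n → ℝ}
    {D₀ D₁ : (Fin n → ℝ) → ℝ → (Fin n → ℝ) →L[ℝ] (Fin n → ℝ)} {x : ℝ → Fin n → ℝ}

lemma clm_integrable {Ψ : ℝ → (Fin n → ℝ) →L[ℝ] (Fin n → ℝ)} {q : ℝ → Fin n → ℝ}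
    (hΨ : ContinuousOn Ψ (Icc 0 T)) (hq : IntegrableOn q (Icc 0 T)) :
    IntegrableOn (fun t => Ψ t (q t)) (Icc 0 T) := by
  obtain ⟨K, hK⟩ := isCompact_Icc.exists_bound_of_continuousOn hΨ
  have hm : AEStronglyMeasurable (fun t => Ψ t (q t)) (volume.restrict (Icc 0 T)) := by
    have h1 : AEStronglyMeasurable Ψ (volume.restrict (Icc 0 T)) :=
      hΨ.aestronglyMeasurable measurableSet_Icc
    exact (ContinuousLinearMap.apply ℝ (Fin n → ℝ)).flip.aestronglyMeasurable_comp₂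
      h1 hq.aestronglyMeasurable
  refine Integrable.mono' (hq.norm.const_mul K) hm ?_
  filter_upwards [ae_restrict_mem measurableSet_Icc] with t ht
  exact (Ψ t).le_of_opNorm_le (hK t ht) _

lemma Setup.core (S : Setup n T s ρ L M C F₀ F₁ D₀ D₁ x)
    {Φ Ψ : ℝ → (Fin n → ℝ) →L[ℝ] (Fin n → ℝ)} (B : (Fin n → ℝ) →L[ℝ] (Fin n → ℝ))
    (hΦ : ContinuousOn Φ (Icc 0 T)) (hΨ : ContinuousOn Ψ (Icc 0 T)) :
    ∃ η > (0 : ℝ), ∃ c : ℝ, ∀ σ, |σ - s| ≤ η → |σ - s| ≤ ρ ∧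
      ∃ z : ℝ → Fin n → ℝ, ContinuousOn z (Icc 0 T) ∧ (∀ t ∈ Icc 0 T, ‖z t‖ ≤ ρ) ∧
      ‖z 0‖ ≤ c * |σ - s| ∧ ∀ t ∈ Icc 0 T, z t =
        Φ t (B (∫ u in (0:ℝ)..T, Ψ u (swG s σ F₀ F₁ D₀ D₁ x z u)) +
          ∫ u in (0:ℝ)..t, Ψ u (swG s σ F₀ F₁ D₀ D₁ x z u)) := by
  have hT : 0 < T := by linarith [S.h1, S.h2, S.hρ]
  have h0T : (0:ℝ) ∈ Icc 0 T := ⟨le_rfl, hT.le⟩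
  have hTT : T ∈ Icc 0 T := ⟨hT.le, le_rfl⟩
  have hρ := S.hρ
  have hL := S.hL
  have hM : 0 ≤ M := (norm_nonneg _).trans (S.m0 0 ⟨le_rfl, by linarith [S.h1, S.hρ]⟩)
  have hC : 0 ≤ C := (norm_nonneg _).trans (S.c0 0 ⟨le_rfl, by linarith [S.h1, S.hρ]⟩)
  obtain ⟨a, ha⟩ := isCompact_Icc.exists_bound_of_continuousOn hΦ
  obtain ⟨b, hb⟩ := isCompact_Icc.exists_bound_of_continuousOn hΨ
  have ha0 : 0 ≤ a := (norm_nonneg _).trans (ha 0 h0T)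
  have hb0 : 0 ≤ b := (norm_nonneg _).trans (hb 0 h0T)
  set K := a * (‖B‖ + 1) with hK
  have hK0 : 0 ≤ K := by positivity
  -- the linear solution operator is bounded
  have lin : ∀ t ∈ Icc 0 T, ∀ u v : Fin n → ℝ, ∀ m, ‖u‖ ≤ m → ‖v‖ ≤ m →
      ‖Φ t (B u + v)‖ ≤ K * m := by
    intro t ht u v m hu hv
    refine ((Φ t).le_of_opNorm_le (ha t ht) _).trans ?_
    have h1 : ‖B u + v‖ ≤ (‖B‖ + 1) * m := by
      refine (norm_add_le _ _).trans ?_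
      have := B.le_opNorm u
      have : ‖B‖ * ‖u‖ ≤ ‖B‖ * m := by gcongr
      linarith
    rw [hK, mul_assoc]
    gcongr
  set r := min ρ ((1/4) / (K * b * L * T + 1)) with hr
  have hr0 : 0 < r := lt_min hρ (by positivity)
  have hrρ : r ≤ ρ := min_le_left _ _
  have hr4 : K * b * L * T * r ≤ 1/4 := aux_small_prod (by positivity) (by norm_num) (min_le_right _ _)
  set η := min ρ (min ((1/4) / (K * b * (L * ρ + 2 * M) + 1)) ((r/2) / (K * b * (2 * C) + 1)))
    with hη
  have hη0 : 0 < η := lt_min hρ (lt_min (by positivity) (by positivity))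
  refine ⟨η, hη0, 2 * (K * b * (2 * C)), ?_⟩
  intro σ hση
  have hσ : |σ - s| ≤ ρ := hση.trans (min_le_left _ _)
  have hη1 : K * b * (L * ρ + 2 * M) * |σ - s| ≤ 1/4 :=
    aux_small_prod (by positivity) (by norm_num)
      (hση.trans ((min_le_right _ _).trans (min_le_left _ _)))
  have hη2 : K * b * (2 * C) * |σ - s| ≤ r / 2 :=
    aux_small_prod (by positivity) (by positivity)
      (hση.trans ((min_le_right _ _).trans (min_le_right _ _)))
  refine ⟨hσ, ?_⟩
  -- the fixed-point operator
  let G : (ℝ → Fin n → ℝ) → ℝ → Fin n → ℝ := fun z u => Ψ u (swG s σ F₀ F₁ D₀ D₁ x z u)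
  let ext : C(Icc 0 T, Fin n → ℝ) → ℝ → Fin n → ℝ := fun z => IccExtend hT.le z
  have extc : ∀ z, Continuous (ext z) := fun z => z.continuous.Icc_extend'
  have extn : ∀ z t, ‖ext z t‖ ≤ ‖z‖ := fun z t => z.norm_coe_le_norm _
  have extd : ∀ z w t, ‖ext z t - ext w t‖ ≤ ‖z - w‖ := fun z w t =>
    (z - w).norm_coe_le_norm (projIcc 0 T hT.le t)
  have Gint : ∀ z : C(Icc 0 T, Fin n → ℝ), ‖z‖ ≤ r → IntegrableOn (G (ext z)) (Icc 0 T) :=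
    fun z hz => clm_integrable hΨ (S.integrable hσ (extc z).continuousOn
      (fun t _ => (extn z t).trans (hz.trans hrρ)))
  have Pex : ∀ z : C(Icc 0 T, Fin n → ℝ), ‖z‖ ≤ r → ∃ w : C(Icc 0 T, Fin n → ℝ),
      ∀ t : Icc 0 T, w t = Φ t (B (∫ u in (0:ℝ)..T, G (ext z) u) +
        ∫ u in (0:ℝ)..t, G (ext z) u) := by
    intro z hz
    have hi := Gint z hz
    have h1 : ContinuousOn (fun t => ∫ u in (0:ℝ)..t, G (ext z) u) (Icc 0 T) := by
      have := intervalIntegral.continuousOn_primitive_interval (a := 0) (b := T) (μ := volume)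
        (f := G (ext z)) (by rwa [uIcc_of_le hT.le])
      rwa [uIcc_of_le hT.le] at this
    have h2 : ContinuousOn (fun t => Φ t (B (∫ u in (0:ℝ)..T, G (ext z) u) +
        ∫ u in (0:ℝ)..t, G (ext z) u)) (Icc 0 T) := hΦ.clm_apply (continuousOn_const.add h1)
    exact ⟨⟨_, h2.domRestrict⟩, fun t => rfl⟩
  choose! P hP using Pex
  have Plip : ∀ z w, ‖z‖ ≤ r → ‖w‖ ≤ r → ‖P z - P w‖ ≤ (1/2) * ‖z - w‖ := by
    intro z w hz hw
    set d := ‖z - w‖ with hd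
    have hd0 : 0 ≤ d := norm_nonneg _
    have bd : ∀ t ∈ Icc 0 T, ‖∫ u in (0:ℝ)..t, (G (ext z) u - G (ext w) u)‖ ≤
        (b * (L * r * d)) * T + (b * ((L * ρ + 2 * M) * d)) * |σ - s| := by
      refine int_bound (by positivity) (by positivity) ?_
      intro t ht
      have h1 := S.lip_bd hσ (z := ext z) (w := ext w) hrρ ht ((extn z t).trans hz)
        ((extn w t).trans hw) (extd z w t)
      have h2 : G (ext z) t - G (ext w) t = Ψ t (swG s σ F₀ F₁ D₀ D₁ x (ext z) t
          - swG s σ F₀ F₁ D₀ D₁ x (ext w) t) := by rw [map_sub]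
      rw [h2]
      refine ((Ψ t).le_of_opNorm_le (hb t ht) _).trans ?_
      refine (mul_le_mul_of_nonneg_left h1 hb0).trans (le_of_eq ?_)
      rw [mul_add]
      congr 1
      by_cases hm : t ∈ uIcc s σ
      · simp [hm, hd]
      · simp [hm]
    have isub : ∀ t ∈ Icc 0 T, ∫ u in (0:ℝ)..t, (G (ext z) u - G (ext w) u) =
        (∫ u in (0:ℝ)..t, G (ext z) u) - ∫ u in (0:ℝ)..t, G (ext w) u := by
      intro t ht
      have hsub : Icc 0 t ⊆ Icc 0 T := Icc_subset_Icc le_rfl ht.2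
      refine intervalIntegral.integral_sub ?_ ?_
      · exact (intervalIntegrable_iff_integrableOn_Icc_of_le ht.1).2 ((Gint z hz).mono_set hsub)
      · exact (intervalIntegrable_iff_integrableOn_Icc_of_le ht.1).2 ((Gint w hw).mono_set hsub)
    rw [ContinuousMap.norm_le _ (by positivity)]
    intro t
    have e : (P z - P w) t = Φ t (B (∫ u in (0:ℝ)..T, (G (ext z) u - G (ext w) u)) +
        ∫ u in (0:ℝ)..t, (G (ext z) u - G (ext w) u)) := by
      rw [ContinuousMap.sub_apply, hP z hz, hP w hw, isub t t.2, isub T hTT]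
      simp only [map_add, map_sub]
      abel
    rw [e]
    refine (lin t t.2 _ _ _ (bd T hTT) (bd t t.2)).trans ?_
    have e2 : K * ((b * (L * r * d)) * T + (b * ((L * ρ + 2 * M) * d)) * |σ - s|) =
      (K * b * L * T * r + K * b * (L * ρ + 2 * M) * |σ - s|) * d := by ring
    rw [e2]
    refine mul_le_mul_of_nonneg_right ?_ hd0
    linarith
  have P0 : ‖P 0‖ ≤ K * b * (2 * C) * |σ - s| := by
    have hz : ‖(0 : C(Icc 0 T, Fin n → ℝ))‖ ≤ r := by simpa using hr0.le
    have bd : ∀ t ∈ Icc 0 T, ‖∫ u in (0:ℝ)..t, G (ext 0) u‖ ≤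
        0 * T + (b * (2 * C)) * |σ - s| := by
      refine int_bound le_rfl (by positivity) ?_
      intro t ht
      have h1 := S.zero_bd hσ ht
      have h2 : G (ext 0) t = Ψ t (swG s σ F₀ F₁ D₀ D₁ x (fun _ => 0) t) := rfl
      rw [h2]
      refine ((Ψ t).le_of_opNorm_le (hb t ht) _).trans ?_
      refine (mul_le_mul_of_nonneg_left h1 hb0).trans (le_of_eq ?_)
      rw [zero_add, zero_add]
      by_cases hm : t ∈ uIcc s σ
      · simp [hm]
      · simp [hm]
    rw [ContinuousMap.norm_le _ (by positivity)]
    intro t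
    rw [hP 0 hz]
    refine (lin t t.2 _ _ _ (bd T hTT) (bd t t.2)).trans (le_of_eq ?_)
    ring
  obtain ⟨z, hzr, hfix, hz2⟩ := fixed_pt hr0.le P Plip (P0.trans hη2)
  refine ⟨ext z, (extc z).continuousOn, fun t _ => (extn z t).trans (hzr.trans hrρ), ?_, ?_⟩
  · refine (extn z 0).trans ?_
    linarith
  · intro t ht
    have h1 : ext z t = z ⟨t, ht⟩ := IccExtend_of_mem _ _ ht
    have h2 := hP z hzr ⟨t, ht⟩
    rw [hfix] at h2
    rw [h1, h2]

lemma Setup.verify (S : Setup n T s ρ L M C F₀ F₁ D₀ D₁ x)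
    {Φ Ψ : ℝ → (Fin n → ℝ) →L[ℝ] (Fin n → ℝ)} (p : Fin n → ℝ)
    (hΨ : ContinuousOn Ψ (Icc 0 T))
    (hΦode : ∀ t ∈ Icc 0 T, t ≠ s → HasDerivWithinAt Φ
      ((if t < s then D₀ (x t) t else D₁ (x t) t).comp (Φ t)) (Icc 0 T) t)
    (hΦΨ : ∀ t ∈ Icc 0 T, ∀ v, Φ t (Ψ t v) = v) {σ : ℝ} (hσ : |σ - s| ≤ ρ)
    {z : ℝ → Fin n → ℝ} (hz : ContinuousOn z (Icc 0 T)) (hzρ : ∀ t ∈ Icc 0 T, ‖z t‖ ≤ ρ)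
    (hfix : ∀ t ∈ Icc 0 T, z t = Φ t (p +
          ∫ u in (0:ℝ)..t, Ψ u (swG s σ F₀ F₁ D₀ D₁ x z u))) :
    ∀ t ∈ Ioo 0 T \ {s, σ}, HasDerivAt (fun t => x t + z t)
      (if t < σ then F₀ (x t + z t) t else F₁ (x t + z t) t) t := by
  rintro t ⟨ht, hne⟩
  have h1 : t ≠ s := fun h => hne (by simp [h])
  have h2 : t ≠ σ := fun h => hne (by simp [h])
  have htc := Ioo_subset_Icc_self ht
  have nh : Icc 0 T ∈ nhds t := Icc_mem_nhds ht.1 ht.2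
  have hx : HasDerivAt x (if t < s then F₀ (x t) t else F₁ (x t) t) t := by
    rcases lt_or_gt_of_ne h1 with h | h
    · rw [if_pos h]
      exact (S.xd0 t ⟨ht.1.le, h⟩).hasDerivAt nh
    · rw [if_neg h.not_gt]
      exact (S.xd1 t ⟨h, ht.2.le⟩).hasDerivAt nh
  have hint := clm_integrable hΨ (S.integrable hσ hz hzρ)
  have hQ : HasDerivAt (fun t => ∫ u in (0:ℝ)..t, Ψ u (swG s σ F₀ F₁ D₀ D₁ x z u))
      (Ψ t (swG s σ F₀ F₁ D₀ D₁ x z t)) t := by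
    refine intervalIntegral.integral_hasDerivAt_right ?_ ?_ ?_
    · exact (intervalIntegrable_iff_integrableOn_Icc_of_le ht.1.le).2
        (hint.mono_set (Icc_subset_Icc le_rfl ht.2.le))
    · exact ⟨Icc 0 T, nh, hint.aestronglyMeasurable⟩
    · exact (hΨ.continuousAt nh).clm_apply (S.contAt hσ hz hzρ ht h1 h2)
  have hd := ((hΦode t htc h1).hasDerivAt nh).clm_apply (hQ.const_add p)
  have hz' : HasDerivAt z _ t := hd.congr_of_eventuallyEq (by
    filter_upwards [nh] with u hu using hfix u hu)
  refine (hx.add hz').congr_deriv ?_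
  rw [ContinuousLinearMap.comp_apply, hΦΨ t htc, ← hfix t htc]
  unfold swG
  by_cases h : t < s
  · simp only [if_pos h]; abel
  · simp only [if_neg h]; abel

lemma Setup.final (S : Setup n T s ρ L M C F₀ F₁ D₀ D₁ x) {σ : ℝ} (hσ : |σ - s| ≤ ρ)
    {z : ℝ → Fin n → ℝ} (hz : ContinuousOn z (Icc 0 T)) (hzρ : ∀ t ∈ Icc 0 T, ‖z t‖ ≤ ρ)
    (hd : ∀ t ∈ Ioo 0 T \ {s, σ}, HasDerivAt (fun t => x t + z t)
      (if t < σ then F₀ (x t + z t) t else F₁ (x t + z t) t) t) :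
    (∀ t ∈ Ico 0 σ, HasDerivWithinAt (fun t => x t + z t) (F₀ (x t + z t) t) (Icc 0 T) t) ∧
    (∀ t ∈ Ioc σ T, HasDerivWithinAt (fun t => x t + z t) (F₁ (x t + z t) t) (Icc 0 T) t) := by
  obtain ⟨a1, a2, a3, a4, a5⟩ := S.sub0 hσ
  have hcnt : ({s, σ} : Set ℝ).Countable := ((finite_singleton σ).insert s).countable
  have hc := S.contF hσ hz hzρ
  have hxz : ContinuousOn (fun t => x t + z t) (Icc 0 T) := S.xc.add hz
  constructor
  · intro t ht
    refine (hasDeriv_of_off_countable (f := fun t => F₀ (x t + z t) t) hcnt (hxz.mono a2) ?_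
      hc.1 t ⟨ht.1, ht.2.le⟩).mono_of_mem_nhdsWithin ?_
    · intro u hu
      have := hd u ⟨⟨hu.1.1, hu.1.2.trans a5.2⟩, hu.2⟩
      rwa [if_pos hu.1.2] at this
    · filter_upwards [self_mem_nhdsWithin, mem_nhdsWithin_of_mem_nhds (Iio_mem_nhds ht.2)]
        with u hu hu2 using ⟨hu.1, le_of_lt hu2⟩
  · intro t ht
    refine (hasDeriv_of_off_countable (f := fun t => F₁ (x t + z t) t) hcnt (hxz.mono a4) ?_
      hc.2 t ⟨ht.1.le, ht.2⟩).mono_of_mem_nhdsWithin ?_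
    · intro u hu
      have := hd u ⟨⟨a5.1.trans hu.1.1, hu.1.2⟩, hu.2⟩
      rwa [if_neg hu.1.1.not_gt] at this
    · filter_upwards [self_mem_nhdsWithin, mem_nhdsWithin_of_mem_nhds (Ioi_mem_nhds ht.1)]
        with u hu hu2 using ⟨le_of_lt hu2, hu.2⟩

end

/-- Lemma 4.1: stability with respect to the switch point. -/
theorem stability_switch_point
    {n : ℕ} (hn : 0 < n) (T s ρ L : ℝ) (hT : 0 < T) (hs : s ∈ Ioo 0 T) (hρ : 0 < ρ)
    (I E : Finset (Fin n)) (hcard : I.card + E.card = n)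
    (bI bE : Fin n → ℝ)
    (F₀ F₁ : (Fin n → ℝ) → ℝ → Fin n → ℝ)
    (DF₀ DF₁ : (Fin n → ℝ) → ℝ → (Fin n → ℝ) →L[ℝ] (Fin n → ℝ))
    (x : ℝ → Fin n → ℝ)
    -- `x` solves the boundary-value problem with switch point `s`
    (hx : IsSwitchSol T s I E bI bE F₀ F₁ x)
    -- Dynamics Smoothness on the two tubes
    (hds₀ : DynSmooth n F₀ DF₀ x 0 (s + ρ) ρ L)
    (hds₁ : DynSmooth n F₁ DF₁ x (s - ρ) T ρ L)
    -- the fundamental matrix `Φ` of the linearized dynamics along `x`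
    (Φ : ℝ → (Fin n → ℝ) →L[ℝ] (Fin n → ℝ))
    (hΦc : ContinuousOn Φ (Icc 0 T))
    (hΦ0 : Φ 0 = ContinuousLinearMap.id ℝ (Fin n → ℝ))
    (hΦode : ∀ t ∈ Icc 0 T, t ≠ s → HasDerivWithinAt Φ
      ((if t < s then DF₀ (x t) t else DF₁ (x t) t).comp (Φ t)) (Icc 0 T) t)
    -- the submatrix `Φ_{EJ}(T)` is invertible, where `J = Iᶜ`
    (N : Matrix {j // j ∈ Iᶜ} {e // e ∈ E} ℝ)
    (hN₁ : (LinearMap.toMatrix' (Φ T : (Fin n → ℝ) →ₗ[ℝ] Fin n → ℝ)).submatrix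
        (Subtype.val : {e // e ∈ E} → Fin n) (Subtype.val : {j // j ∈ Iᶜ} → Fin n) * N = 1)
    (hN₂ : N * (LinearMap.toMatrix' (Φ T : (Fin n → ℝ) →ₗ[ℝ] Fin n → ℝ)).submatrix
        (Subtype.val : {e // e ∈ E} → Fin n) (Subtype.val : {j // j ∈ Iᶜ} → Fin n) = 1) :
    -- for all `Δs` small, the problem with switch point `s + Δs` has a solution `x⁺`
    -- with `‖x⁺_J(0) - x_J(0)‖ ≤ c|Δs|`
    ∃ η > (0 : ℝ), ∃ c : ℝ, ∀ Δs : ℝ, |Δs| ≤ η →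
      ∃ xp : ℝ → Fin n → ℝ, IsSwitchSol T (s + Δs) I E bI bE F₀ F₁ xp ∧
        ‖(fun j : {j // j ∈ Iᶜ} => xp 0 j.1 - x 0 j.1)‖ ≤ c * |Δs| := by
  obtain ⟨xc, xd0, xd1, xI, xE⟩ := hx
  -- shrink the tube
  set ρ' := min ρ (min (s / 2) ((T - s) / 2)) with hρ'
  have hs1 := hs.1
  have hs2 := hs.2
  have r0 : 0 < ρ' := lt_min hρ (lt_min (by linarith) (by linarith))
  have r1 : ρ' ≤ ρ := min_le_left _ _
  have r2 : ρ' ≤ s / 2 := (min_le_right _ _).trans (min_le_left _ _)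
  have r3 : ρ' ≤ (T - s) / 2 := (min_le_right _ _).trans (min_le_right _ _)
  have d0 : DynSmooth n F₀ DF₀ x 0 (s + ρ') ρ' |L| :=
    hds₀.mono' le_rfl (by linarith) r1 (le_abs_self L)
  have d1 : DynSmooth n F₁ DF₁ x (s - ρ') T ρ' |L| :=
    hds₁.mono' (by linarith) le_rfl r1 (le_abs_self L)
  have xc0 : ContinuousOn x (Icc 0 (s + ρ')) := xc.mono (Icc_subset_Icc le_rfl (by linarith))
  have xc1 : ContinuousOn x (Icc (s - ρ') T) := xc.mono (Icc_subset_Icc (by linarith) le_rfl)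
  have cD0 := d0.cont_D r0.le Subset.rfl xc0
  have cD1 := d1.cont_D r0.le Subset.rfl xc1
  have cF0 := d0.cont_comp Subset.rfl xc0 (by simpa using fun _ _ _ => r0.le)
  have cF1 := d1.cont_comp Subset.rfl xc1 (by simpa using fun _ _ _ => r0.le)
  obtain ⟨M0, hM0⟩ := isCompact_Icc.exists_bound_of_continuousOn cD0
  obtain ⟨M1, hM1⟩ := isCompact_Icc.exists_bound_of_continuousOn cD1
  obtain ⟨C0, hC0⟩ := isCompact_Icc.exists_bound_of_continuousOn cF0
  obtain ⟨C1, hC1⟩ := isCompact_Icc.exists_bound_of_continuousOn cF1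
  have S : Setup n T s ρ' |L| (max M0 M1) (max C0 C1) F₀ F₁ DF₀ DF₁ x :=
    { hρ := r0
      h1 := by linarith
      h2 := by linarith
      hL := abs_nonneg L
      d0 := d0
      d1 := d1
      xc := xc
      xd0 := xd0
      xd1 := xd1
      m0 := fun t ht => (hM0 t ht).trans (le_max_left _ _)
      m1 := fun t ht => (hM1 t ht).trans (le_max_right _ _)
      c0 := fun t ht => (hC0 t ht).trans (le_max_left _ _)
      c1 := fun t ht => (hC1 t ht).trans (le_max_right _ _) }
  obtain ⟨Ψ, hΨc, hΨ⟩ := exists_Psi hs (A₀ := fun t => DF₀ (x t) t) (A₁ := fun t => DF₁ (x t) t)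
    (cD0.mono (Icc_subset_Icc le_rfl (by linarith)))
    (cD1.mono (Icc_subset_Icc (by linarith) le_rfl)) hΦc hΦ0 hΦode
  obtain ⟨B, hB1, hB2⟩ := exists_B I E (Φ T) N hN₁
  obtain ⟨η, hη, c, hc⟩ := S.core B hΦc hΨc
  refine ⟨η, hη, c, ?_⟩
  intro Δs hΔ
  have hΔ' : s + Δs - s = Δs := by ring
  obtain ⟨hσ, z, hz, hzρ, hz0, hfix⟩ := hc (s + Δs) (by rwa [hΔ'])
  rw [hΔ'] at hz0
  have hd := S.verify _ hΨc hΦode hΨ hσ hz hzρ hfix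
  have hf := S.final hσ hz hzρ hd
  refine ⟨fun t => x t + z t, ⟨xc.add hz, hf.1, hf.2, ?_, ?_⟩, ?_⟩
  · intro i hi
    have h1 := hfix 0 ⟨le_rfl, hT.le⟩
    rw [hΦ0, intervalIntegral.integral_same, add_zero] at h1
    have h2 : z 0 i = 0 := by
      rw [h1]
      exact hB1 _ i hi
    simp [h2, xI i hi]
  · intro i hi
    have h1 := hfix T ⟨hT.le, le_rfl⟩
    have h2 : z T i = 0 := by
      rw [h1]
      exact hB2 _ i hi
    simp [h2, xE i hi]
  · refine le_trans ?_ hz0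
    rw [pi_norm_le_iff_of_nonneg (norm_nonneg _)]
    intro j
    simpa using norm_le_pi_norm (z 0) j.1
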